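/- For every positive integer n, r_3(n) = 6·(−1)^{n+1} · Σ (−1)^{r+s} + 4·(−1)^{n+1} · Σ (−1)^{r+s+t}, where the first sum is over ordered pairs of positive integers (r,s) with rs = n and the second sum is over ordered triples of positive integers (r,s,t) with rs + rt + st = n (the Andrews–Crandall identity). -/

import Mathlib

/-- `r₃ n` is the number of ordered triples `(x,y,z) ∈ ℤ³` with `x² + y² + z² = n`. -/
noncomputable def r3 (n : ℕ) : ℕ :=
  Set.ncard {v : ℤ × ℤ × ℤ | v.1 ^ 2 + v.2.1 ^ 2 + v.2.2 ^ 2 = (n : ℤ)}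

/-- The parity sign of an integer: `1` on even and `-1` on odd integers. -/
def paritySign (k : ℤ) : ℤ := if k % 2 = 0 then 1 else -1

theorem paritySign_add (k l : ℤ) : paritySign (k + l) = paritySign k * paritySign l := by
  unfold paritySign
  split_ifs <;> first | rfl | omega

theorem paritySign_congr {k l : ℤ} (h : (k - l) % 2 = 0) : paritySign k = paritySign l := by
  unfold paritySign
  split_ifs <;> first | rfl | omega

theorem paritySign_natCast (k : ℕ) : paritySign k = (-1) ^ k := by
  unfold paritySign
  rcases Nat.even_or_odd k with h | h
  · rw [if_pos (by have := Nat.even_iff.1 h; omega), h.neg_one_pow]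
  · rw [if_neg (by have := Nat.odd_iff.1 h; omega), h.neg_one_pow]

section Finsum

variable {α β : Type*} {S : Set α} {T : Set β}

theorem finsum_mem_bij {f : α → ℤ} {g : β → ℤ} (i : α → β) (j : β → α)
    (hi : ∀ a ∈ S, i a ∈ T) (hj : ∀ b ∈ T, j b ∈ S) (hji : ∀ a ∈ S, j (i a) = a)
    (hij : ∀ b ∈ T, i (j b) = b) (h : ∀ a ∈ S, f a = g (i a)) :
    ∑ᶠ a ∈ S, f a = ∑ᶠ b ∈ T, g b := by
  refine finsum_mem_eq_of_bijOn i ⟨hi, ?_, ?_⟩ h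
  · intro a ha b hb hab
    rw [← hji a ha, ← hji b hb, hab]
  · intro b hb
    exact ⟨j b, hj b hb, hij b hb⟩

/-- A sum cancels under an involution that reverses the sign of the summand. -/
theorem finsum_mem_eq_zero_of_involution {f : α → ℤ} (i : α → α) (hi : ∀ a ∈ S, i a ∈ S)
    (hii : ∀ a ∈ S, i (i a) = a) (h : ∀ a ∈ S, f (i a) = -f a) : ∑ᶠ a ∈ S, f a = 0 := by
  have h1 : ∑ᶠ a ∈ S, f a = ∑ᶠ a ∈ S, -f a :=
    finsum_mem_bij i i hi hi hii hii fun a ha => by rw [h a ha, neg_neg]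
  have h2 : ∑ᶠ a ∈ S, -f a = -∑ᶠ a ∈ S, f a := by
    simp only [← finsum_neg_distrib]
  omega

theorem finsum_mem_split (hS : S.Finite) (p : α → Prop) (f : α → ℤ) :
    ∑ᶠ a ∈ S, f a = ∑ᶠ a ∈ {a ∈ S | p a}, f a + ∑ᶠ a ∈ {a ∈ S | ¬ p a}, f a := by
  rw [← finsum_mem_union _ (hS.subset fun a h => h.1) (hS.subset fun a h => h.1)]
  · refine finsum_mem_congr (Set.ext fun a => ?_) fun _ _ => rfl
    simp only [Set.mem_union, Set.mem_ofPred_eq]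
    tauto
  · rw [Set.disjoint_left]
    exact fun a h h' => h'.2 h.2

theorem finsum_mem_sep_eq_ite (p : α → Prop) [DecidablePred p] (f : α → ℤ) :
    ∑ᶠ a ∈ {a ∈ S | p a}, f a = ∑ᶠ a ∈ S, if p a then f a else 0 := by
  classical
  simp only [finsum_mem_def]
  refine finsum_congr fun a => ?_
  simp only [Set.indicator_apply, Set.mem_ofPred_eq]
  split_ifs <;> tauto

end Finsum

/-- The representations `i ^ 2 + d e = n` with `d` and `e` positive. -/
def squareProductSet (n : ℤ) : Set (ℤ × ℤ × ℤ) :=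
  {p | 0 < p.2.1 ∧ 0 < p.2.2 ∧ p.1 ^ 2 + p.2.1 * p.2.2 = n}

theorem mem_squareProductSet {n i d e : ℤ} :
    (i, d, e) ∈ squareProductSet n ↔ 0 < d ∧ 0 < e ∧ i ^ 2 + d * e = n := Iff.rfl

theorem finite_squareProductSet (n : ℤ) : (squareProductSet n).Finite := by
  refine ((Set.finite_Icc (-n) n).prod ((Set.finite_Icc 0 n).prod (Set.finite_Icc 0 n))).subset ?_
  rintro ⟨i, d, e⟩ ⟨hd, he, h⟩
  simp only [Set.mem_prod, Set.mem_Icc] at *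
  have := Int.le_self_sq i
  have := Int.le_self_sq (-i)
  refine ⟨⟨?_, ?_⟩, ⟨?_, ?_⟩, ?_, ?_⟩ <;> nlinarith

theorem finite_sq_eq (n : ℤ) : {x : ℤ | x ^ 2 = n}.Finite := by
  refine (Set.finite_Icc (-n) n).subset ?_
  intro i h
  simp only [Set.mem_Icc, Set.mem_ofPred_eq] at *
  constructor <;> nlinarith

theorem setOf_sq_eq_sq (m : ℤ) : {x : ℤ | x ^ 2 = m ^ 2} = {m, -m} := by
  ext x
  simp [sq_eq_sq_iff_eq_or_eq_neg]

theorem sum_range_alternating (k : ℕ) (M : ℤ) :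
    ∑ d ∈ Finset.range (2 * k), paritySign d * (d * (M - d)) =
      -k * M + 2 * k * (k - 1) + k := by
  induction k with
  | zero => simp
  | succ k ih =>
    rw [show 2 * (k + 1) = 2 * k + 1 + 1 by ring, Finset.sum_range_succ, Finset.sum_range_succ, ih]
    have h1 : paritySign ((2 * k : ℕ) : ℤ) = 1 := if_pos (by omega)
    have h2 : paritySign ((2 * k + 1 : ℕ) : ℤ) = -1 := if_neg (by omega)
    rw [h1, h2]
    push_cast
    ring

theorem sum_squareProductSet_diagonal (n : ℤ) :
    ∑ᶠ p ∈ {p ∈ squareProductSet n | p.2.2 = 2 * p.1 + p.2.1},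
      paritySign (p.1 + p.2.1 + p.2.2) *
        ((p.2.1 + p.2.2) * (p.2.1 + 2 * p.1) * (p.2.2 - 2 * p.1)) =
      -∑ᶠ x ∈ {x : ℤ | x ^ 2 = n}, paritySign x * x ^ 2 := by
  by_cases hm : ∃ m : ℕ, 0 < m ∧ (m : ℤ) ^ 2 = n
  · obtain ⟨m, hm, rfl⟩ := hm
    rw [setOf_sq_eq_sq, finsum_mem_pair (by omega)]
    have h1 : paritySign (-(m : ℤ)) = paritySign m := paritySign_congr (by omega)
    trans ∑ᶠ d ∈ (Finset.Ioo 0 (2 * m) : Set ℕ),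
      2 * m * paritySign m * (paritySign d * (d * (2 * m - d)))
    · refine finsum_mem_bij (fun p => p.2.1.toNat) (fun d => (m - d, (d : ℤ), 2 * (m : ℤ) - d))
        ?_ ?_ ?_ ?_ ?_
      · rintro ⟨i, d, e⟩ ⟨⟨hd, he, h⟩, h'⟩
        simp only [Finset.coe_Ioo, Set.mem_Ioo] at *
        have : (i + d - m) * (i + d + m) = 0 := by subst h'; linear_combination h
        rcases mul_eq_zero.1 this with h | h <;> omega
      · intro d hd
        simp only [Finset.coe_Ioo, Set.mem_Ioo] at hd
        refine ⟨⟨?_, ?_, ?_⟩, ?_⟩ <;> dsimp only <;> first | omega | ring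
      · rintro ⟨i, d, e⟩ ⟨⟨hd, he, h⟩, h'⟩
        simp only at *
        have : (i + d - m) * (i + d + m) = 0 := by subst h'; linear_combination h
        rcases mul_eq_zero.1 this with h | h
        · ext <;> dsimp only <;> omega
        · omega
      · intro d hd
        simp
      · rintro ⟨i, d, e⟩ ⟨⟨hd, he, h⟩, h'⟩
        simp only at *
        have : (i + d - m) * (i + d + m) = 0 := by subst h'; linear_combination h
        rcases mul_eq_zero.1 this with h | h
        · rw [Int.toNat_of_nonneg hd.le, paritySign_congr (k := i + d + e) (l := m + d) (by omega),
            paritySign_add]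
          obtain rfl : i = m - d := by omega
          subst h'
          ring
        · omega
    · rw [finsum_mem_coe_finset, ← Finset.mul_sum]
      have h2 := sum_range_alternating m (2 * m)
      rw [Finset.range_eq_Ico, ← Finset.Ioo_insert_left (by omega), Finset.sum_insert (by simp)] at h2
      simp only [Nat.cast_zero, zero_mul, mul_zero, zero_add] at h2
      rw [h2, h1]
      ring
  · have h1 : ∑ᶠ x ∈ {x : ℤ | x ^ 2 = n}, paritySign x * x ^ 2 = 0 := by
      refine finsum_mem_eq_zero_of_forall_eq_zero fun x hx => ?_
      by_cases h0 : x = 0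
      · simp [h0]
      · exact absurd ⟨x.natAbs, Int.natAbs_pos.2 h0, by rw [Int.natAbs_sq]; exact hx⟩ hm
    rw [h1, neg_zero]
    refine finsum_mem_eq_zero_of_forall_eq_zero ?_
    rintro ⟨i, d, e⟩ ⟨⟨hd, he, h⟩, h'⟩
    simp only at *
    refine absurd ⟨(i + d).toNat, by omega, ?_⟩ hm
    rw [Int.toNat_of_nonneg (by omega), ← h, h']
    ring

theorem sum_squareProductSet_weighted (n : ℤ) :
    ∑ᶠ p ∈ squareProductSet n, paritySign (p.1 + p.2.1 + p.2.2) *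
        ((p.2.1 * p.2.2 - 4 * p.1 ^ 2) * (p.2.1 + p.2.2)) =
      -∑ᶠ x ∈ {x : ℤ | x ^ 2 = n}, paritySign x * x ^ 2 := by
  have hS := finite_squareProductSet n
  rw [← sum_squareProductSet_diagonal]
  set P : ℤ × ℤ × ℤ → ℤ := fun p => paritySign (p.1 + p.2.1 + p.2.2) *
        ((p.2.1 + p.2.2) * (p.2.1 + 2 * p.1) * (p.2.2 - 2 * p.1)) with hP
  have h0 : ∑ᶠ p ∈ squareProductSet n, (paritySign (p.1 + p.2.1 + p.2.2) *
        ((p.2.1 * p.2.2 - 4 * p.1 ^ 2) * (p.2.1 + p.2.2)) - P p) = 0 := by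
    refine finsum_mem_eq_zero_of_involution (fun p => (-p.1, p.2)) ?_ ?_ ?_
    · rintro ⟨i, d, e⟩ ⟨hd, he, h⟩
      exact ⟨hd, he, by simpa using h⟩
    · simp
    · rintro ⟨i, d, e⟩ -
      simp only [hP]
      rw [paritySign_congr (k := -i + d + e) (l := i + d + e) (by omega)]
      ring
  rw [finsum_mem_sub_distrib _ _ hS, sub_eq_zero] at h0
  rw [h0, finsum_mem_split hS (fun p => 2 * p.1 + p.2.1 < p.2.2)]
  have h1 : ∑ᶠ p ∈ {p ∈ squareProductSet n | 2 * p.1 + p.2.1 < p.2.2}, P p = 0 := by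
    refine finsum_mem_eq_zero_of_involution
      (fun p => (-p.1 - p.2.1, p.2.1, p.2.2 - 2 * p.1 - p.2.1)) ?_ ?_ ?_
    · rintro ⟨i, d, e⟩ ⟨⟨hd, he, h⟩, h'⟩
      simp only [Set.mem_ofPred_eq, mem_squareProductSet] at *
      exact ⟨⟨hd, by omega, by linear_combination h⟩, by omega⟩
    · rintro ⟨i, d, e⟩ -
      ext <;> dsimp only <;> ring
    · rintro ⟨i, d, e⟩ -
      simp only [hP]
      rw [paritySign_congr (k := -i - d + d + (e - 2 * i - d)) (l := i + d + e) (by omega)]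
      ring
  rw [h1, zero_add, finsum_mem_split (hS.subset fun _ h => h.1) (fun p => p.2.2 < 2 * p.1 + p.2.1)]
  have h2 : ∑ᶠ p ∈ {p ∈ {p ∈ squareProductSet n | ¬ 2 * p.1 + p.2.1 < p.2.2} |
      p.2.2 < 2 * p.1 + p.2.1}, P p = 0 := by
    refine finsum_mem_eq_zero_of_involution
      (fun p => (p.2.2 - p.1, 2 * p.1 + p.2.1 - p.2.2, p.2.2)) ?_ ?_ ?_
    · rintro ⟨i, d, e⟩ ⟨⟨⟨hd, he, h⟩, -⟩, h'⟩
      simp only [Set.mem_ofPred_eq, mem_squareProductSet] at *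
      exact ⟨⟨⟨by omega, he, by linear_combination h⟩, by omega⟩, by omega⟩
    · rintro ⟨i, d, e⟩ -
      ext <;> dsimp only <;> ring
    · rintro ⟨i, d, e⟩ -
      simp only [hP]
      rw [paritySign_congr (k := e - i + (2 * i + d - e) + e) (l := i + d + e) (by omega)]
      ring
  rw [h2, zero_add]
  refine finsum_mem_congr (Set.ext fun p => ?_) fun _ _ => rfl
  simp only [Set.mem_ofPred_eq]
  constructor
  · rintro ⟨⟨h1, h2⟩, h3⟩
    exact ⟨h1, by omega⟩
  · rintro ⟨h1, h2⟩
    exact ⟨⟨h1, by omega⟩, by omega⟩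

theorem finsum_mem_fiberwise {α β : Type*} {S : Set α} (hS : S.Finite) (t : α → Finset β)
    (f : α × β → ℤ) :
    ∑ᶠ p ∈ {p : α × β | p.1 ∈ S ∧ p.2 ∈ t p.1}, f p = ∑ᶠ a ∈ S, ∑ b ∈ t a, f (a, b) := by
  classical
  have hU : {p : α × β | p.1 ∈ S ∧ p.2 ∈ t p.1}.Finite := by
    refine (hS.toFinset.sigma t).finite_toSet.image (fun q => (q.1, q.2)) |>.subset ?_
    rintro ⟨a, b⟩ ⟨h1, h2⟩
    exact ⟨⟨a, b⟩, by simpa using ⟨h1, h2⟩, rfl⟩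
  rw [finsum_mem_eq_finite_toFinset_sum _ hS, finsum_mem_eq_finite_toFinset_sum _ hU]
  exact Finset.sum_finset_product _ _ _ fun p => by simp

/-- The factorizations `c m = n` into positive integers. -/
def productSet (n : ℤ) : Set (ℤ × ℤ) := {p | 0 < p.1 ∧ 0 < p.2 ∧ p.1 * p.2 = n}

/-- The representations `r s + r t + s t = n` by positive integers. -/
def tripleSet (n : ℤ) : Set (ℤ × ℤ × ℤ) :=
  {p | 0 < p.1 ∧ 0 < p.2.1 ∧ 0 < p.2.2 ∧ p.1 * p.2.1 + p.1 * p.2.2 + p.2.1 * p.2.2 = n}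

/-- The representations `x ^ 2 + (r s + r t + s t) = n` with `r`, `s` and `t` positive. -/
def squareTripleSet (n : ℤ) : Set (ℤ × ℤ × ℤ × ℤ) :=
  {p | 0 < p.2.1 ∧ 0 < p.2.2.1 ∧ 0 < p.2.2.2 ∧
    p.1 ^ 2 + (p.2.1 * p.2.2.1 + p.2.1 * p.2.2.2 + p.2.2.1 * p.2.2.2) = n}

theorem finite_productSet (n : ℤ) : (productSet n).Finite := by
  refine ((Set.finite_Icc 0 n).prod (Set.finite_Icc 0 n)).subset ?_
  rintro ⟨d, e⟩ ⟨hd, he, h⟩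
  simp only [Set.mem_prod, Set.mem_Icc] at *
  refine ⟨⟨?_, ?_⟩, ?_, ?_⟩ <;> nlinarith

theorem finite_tripleSet (n : ℤ) : (tripleSet n).Finite := by
  refine ((Set.finite_Icc 0 n).prod ((Set.finite_Icc 0 n).prod (Set.finite_Icc 0 n))).subset ?_
  rintro ⟨r, s, t⟩ ⟨hr, hs, ht, h⟩
  simp only [Set.mem_prod, Set.mem_Icc] at *
  have := mul_pos hr hs
  have := mul_pos hr ht
  have := mul_pos hs ht
  refine ⟨⟨?_, ?_⟩, ⟨?_, ?_⟩, ?_, ?_⟩ <;> nlinarith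

theorem sum_Icc_paritySign {K : ℤ} (hK : 0 ≤ K) :
    ∑ m ∈ Finset.Icc 1 K, paritySign m = if K % 2 = 0 then 0 else -1 := by
  induction K, hK using Int.leInduction with
  | base => simp
  | succ k hk ih =>
    rw [show Finset.Icc 1 (k + 1) = insert (k + 1) (Finset.Icc 1 k) by ext; simp; omega,
      Finset.sum_insert (by simp), ih]
    unfold paritySign
    split_ifs <;> omega

/-- The number of orderings of a pair of integers with difference `l`. -/
def swapWeight (l : ℤ) : ℤ := if l = 0 then 1 else 2

theorem sum_Icc_swapWeight {M : ℤ} (hM : 0 < M) :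
    ∑ b ∈ Finset.Icc 1 M, swapWeight (M - b) = 2 * M - 1 := by
  have h : ∀ b ∈ Finset.Icc 1 M, swapWeight (M - b) = 2 - if b = M then 1 else 0 := by
    intro b _
    unfold swapWeight
    split_ifs <;> omega
  rw [Finset.sum_congr rfl h, Finset.sum_sub_distrib, Finset.sum_ite_eq',
    if_pos (Finset.mem_Icc.2 ⟨hM, le_rfl⟩)]
  simp [hM.le]
  ring

theorem finsum_mem_symmetrize {α : Type*} {S : Set α} (hS : S.Finite) (i : α → α) (k : α → ℤ)
    (f : α → ℤ) (hi : ∀ a ∈ S, i a ∈ S) (hii : ∀ a ∈ S, i (i a) = a)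
    (hk : ∀ a ∈ S, k (i a) = -k a) (hf : ∀ a ∈ S, f (i a) = f a) :
    ∑ᶠ a ∈ S, f a = ∑ᶠ a ∈ {a ∈ S | 0 ≤ k a}, swapWeight (k a) * f a := by
  have h1 : ∑ᶠ a ∈ {a ∈ S | ¬ 0 ≤ k a}, f a = ∑ᶠ a ∈ {a ∈ S | 0 < k a}, f a := by
    refine finsum_mem_bij i i ?_ ?_ ?_ ?_ ?_
    · intro a ha
      exact ⟨hi a ha.1, by have := hk a ha.1; have := ha.2; omega⟩
    · intro a ha
      exact ⟨hi a ha.1, by have := hk a ha.1; have := ha.2; omega⟩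
    · exact fun a ha => hii a ha.1
    · exact fun a ha => hii a ha.1
    · exact fun a ha => (hf a ha.1).symm
  rw [finsum_mem_split hS (fun a => 0 ≤ k a), h1, finsum_mem_sep_eq_ite, finsum_mem_sep_eq_ite,
    finsum_mem_sep_eq_ite, ← finsum_mem_add_distrib hS]
  refine finsum_mem_congr rfl fun a _ => ?_
  unfold swapWeight
  split_ifs <;> omega

theorem sum_productSet_eq (n : ℤ) :
    ∑ᶠ p ∈ productSet n, paritySign (p.1 + p.2) =
      ∑ᶠ p ∈ {p ∈ productSet n | 0 ≤ p.2 - p.1},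
        swapWeight (p.2 - p.1) * paritySign (p.1 + p.2) := by
  refine finsum_mem_symmetrize (finite_productSet n) Prod.swap (fun p => p.2 - p.1) _ ?_ ?_ ?_ ?_
  · rintro ⟨a, b⟩ ⟨h1, h2, h3⟩
    exact ⟨h2, h1, by simpa [mul_comm] using h3⟩
  · simp
  · simp
  · simp [add_comm]

/-- The representations `u v + d e = n` with `d`, `e` positive and `|u - v| < 2 min (d, e)`. -/
def bandSet (n : ℤ) : Set (ℤ × ℤ × ℤ × ℤ) :=
  {p | 0 < p.2.2.1 ∧ 0 < p.2.2.2 ∧ p.1 * p.2.1 + p.2.2.1 * p.2.2.2 = n ∧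
    |p.1 - p.2.1| < 2 * p.2.2.1 ∧ |p.1 - p.2.1| < 2 * p.2.2.2}

theorem finite_bandSet (n : ℤ) : (bandSet n).Finite := by
  refine ((Set.finite_Icc (-8 * n) (8 * n)).prod ((Set.finite_Icc (-8 * n) (8 * n)).prod
    ((Set.finite_Icc 0 (2 * n)).prod (Set.finite_Icc 0 (2 * n))))).subset ?_
  rintro ⟨u, v, d, e⟩ ⟨hd, he, h, h1, h2⟩
  simp only [Set.mem_prod, Set.mem_Icc] at *
  have h3 : (u - v) ^ 2 ≤ (2 * d - 1) * (2 * e - 1) := by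
    rw [← sq_abs, sq]
    exact mul_le_mul (by omega) (by omega) (abs_nonneg _) (by omega)
  have h4 : (u + v) ^ 2 + (2 * d + 2 * e - 1) ≤ 4 * n := by rw [← h]; linarith
  have h5 := Int.le_self_sq (u + v)
  have h6 := Int.le_self_sq (-(u + v))
  have h7 := sq_nonneg (u + v)
  rw [neg_sq] at h6
  rw [abs_lt] at h1
  refine ⟨⟨?_, ?_⟩, ⟨?_, ?_⟩, ⟨?_, ?_⟩, ?_, ?_⟩ <;> omega

theorem sum_bandSet_eq (n : ℤ) :
    ∑ᶠ p ∈ bandSet n, paritySign (p.1 + p.2.2.1 + p.2.2.2) =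
      2 * ∑ᶠ p ∈ squareTripleSet n, paritySign (p.1 + p.2.1 + p.2.2.1 + p.2.2.2) +
      ∑ᶠ p ∈ squareProductSet n, paritySign (p.1 + p.2.1 + p.2.2) := by
  have hG := finite_bandSet n
  rw [finsum_mem_split hG (fun p => (p.1 - p.2.1) % 2 = 0),
    finsum_mem_split (hG.subset fun _ h => h.1) (fun p => p.1 < p.2.1),
    finsum_mem_split (S := {p ∈ {p ∈ bandSet n | (p.1 - p.2.1) % 2 = 0} | ¬ p.1 < p.2.1})
      (hG.subset fun _ h => h.1.1) (fun p => p.2.1 < p.1)]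
  have h1 : ∑ᶠ p ∈ {p ∈ bandSet n | ¬ (p.1 - p.2.1) % 2 = 0},
      paritySign (p.1 + p.2.2.1 + p.2.2.2) = 0 := by
    refine finsum_mem_eq_zero_of_involution (fun p => (p.2.1, p.1, p.2.2)) ?_ (by simp) ?_
    · rintro ⟨u, v, d, e⟩ ⟨⟨hd, he, h, h1, h2⟩, h3⟩
      dsimp only at *
      rw [abs_sub_comm] at h1 h2
      exact ⟨⟨hd, he, by rw [← h]; ring, h1, h2⟩, by dsimp only; omega⟩
    · rintro ⟨u, v, d, e⟩ ⟨-, h3⟩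
      dsimp only at *
      unfold paritySign
      split_ifs <;> omega
  have h2 : ∑ᶠ p ∈ {p ∈ {p ∈ bandSet n | (p.1 - p.2.1) % 2 = 0} | p.1 < p.2.1},
      paritySign (p.1 + p.2.2.1 + p.2.2.2) =
      ∑ᶠ p ∈ squareTripleSet n, paritySign (p.1 + p.2.1 + p.2.2.1 + p.2.2.2) := by
    refine finsum_mem_bij
      (fun p => ((p.1 + p.2.1) / 2, p.2.2.1 - (p.2.1 - p.1) / 2, p.2.2.2 - (p.2.1 - p.1) / 2,
        (p.2.1 - p.1) / 2))
      (fun p => (p.1 - p.2.2.2, p.1 + p.2.2.2, p.2.1 + p.2.2.2, p.2.2.1 + p.2.2.2)) ?_ ?_ ?_ ?_ ?_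
    · rintro ⟨u, v, d, e⟩ ⟨⟨⟨hd, he, h, h1, h2⟩, h3⟩, h4⟩
      dsimp only at *
      obtain ⟨t, ht⟩ : ∃ t, v = u + 2 * t := ⟨(v - u) / 2, by omega⟩
      rw [abs_lt] at h1 h2
      obtain rfl : u = v - 2 * t := by omega
      rw [show (v - 2 * t + v) / 2 = v - t by omega, show (v - (v - 2 * t)) / 2 = t by omega]
      refine ⟨?_, ?_, ?_, ?_⟩ <;> dsimp only <;> first | omega | linear_combination h
    · rintro ⟨x, r, s, t⟩ ⟨hr, hs, ht, h⟩
      dsimp only at *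
      refine ⟨⟨⟨?_, ?_, ?_, ?_, ?_⟩, ?_⟩, ?_⟩ <;> dsimp only <;>
        first | omega | linear_combination h | (rw [abs_lt]; omega)
    · rintro ⟨u, v, d, e⟩ ⟨⟨⟨hd, he, h, h1, h2⟩, h3⟩, h4⟩
      ext <;> dsimp only at * <;> omega
    · rintro ⟨x, r, s, t⟩ -
      ext <;> dsimp only <;> omega
    · rintro ⟨u, v, d, e⟩ ⟨⟨⟨hd, he, h, h1, h2⟩, h3⟩, h4⟩
      dsimp only at *
      exact paritySign_congr (by omega)
  have h3 : ∑ᶠ p ∈ {p ∈ {p ∈ {p ∈ bandSet n | (p.1 - p.2.1) % 2 = 0} | ¬ p.1 < p.2.1} |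
        p.2.1 < p.1}, paritySign (p.1 + p.2.2.1 + p.2.2.2) =
      ∑ᶠ p ∈ {p ∈ {p ∈ bandSet n | (p.1 - p.2.1) % 2 = 0} | p.1 < p.2.1},
      paritySign (p.1 + p.2.2.1 + p.2.2.2) := by
    refine finsum_mem_bij (fun p => (p.2.1, p.1, p.2.2)) (fun p => (p.2.1, p.1, p.2.2))
      ?_ ?_ (by simp) (by simp) ?_
    · rintro ⟨u, v, d, e⟩ ⟨⟨⟨⟨hd, he, h, h1, h2⟩, h3⟩, h4⟩, h5⟩
      dsimp only at *
      rw [abs_sub_comm] at h1 h2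
      refine ⟨⟨⟨hd, he, ?_, h1, h2⟩, ?_⟩, ?_⟩ <;> dsimp only <;> first | omega | linarith
    · rintro ⟨u, v, d, e⟩ ⟨⟨⟨hd, he, h, h1, h2⟩, h3⟩, h4⟩
      dsimp only at *
      rw [abs_sub_comm] at h1 h2
      refine ⟨⟨⟨⟨hd, he, ?_, h1, h2⟩, ?_⟩, ?_⟩, ?_⟩ <;> dsimp only <;> first | omega | linarith
    · rintro ⟨u, v, d, e⟩ ⟨⟨⟨-, h3⟩, -⟩, -⟩
      dsimp only at *
      exact paritySign_congr (by omega)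
  have h4 : ∑ᶠ p ∈ {p ∈ {p ∈ {p ∈ bandSet n | (p.1 - p.2.1) % 2 = 0} | ¬ p.1 < p.2.1} |
        ¬ p.2.1 < p.1}, paritySign (p.1 + p.2.2.1 + p.2.2.2) =
      ∑ᶠ p ∈ squareProductSet n, paritySign (p.1 + p.2.1 + p.2.2) := by
    refine finsum_mem_bij (fun p => p.2) (fun p => (p.1, p)) ?_ ?_ ?_ (by simp) ?_
    · rintro ⟨u, v, d, e⟩ ⟨⟨⟨⟨hd, he, h, h1, h2⟩, h3⟩, h4⟩, h5⟩
      dsimp only at *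
      obtain rfl : u = v := by omega
      exact ⟨hd, he, by rw [← h]; ring⟩
    · rintro ⟨u, d, e⟩ ⟨hd, he, h⟩
      dsimp only at *
      refine ⟨⟨⟨⟨hd, he, ?_, ?_, ?_⟩, ?_⟩, ?_⟩, ?_⟩ <;> dsimp only <;>
        first | omega | linarith | simpa
    · rintro ⟨u, v, d, e⟩ ⟨⟨⟨-, h3⟩, h4⟩, h5⟩
      exact Prod.ext (by dsimp only at *; omega) rfl
    · rintro ⟨u, v, d, e⟩ ⟨⟨⟨-, h3⟩, h4⟩, h5⟩
      dsimp only at *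
      exact paritySign_congr (by omega)
  rw [h1, h3, h2, h4]
  ring

theorem sum_bandSet_axis (n : ℤ) :
    ∑ᶠ p ∈ {p ∈ bandSet n | p.2.1 = 0}, paritySign (p.1 + p.2.2.1 + p.2.2.2) =
      -∑ᶠ p ∈ productSet n, paritySign (p.1 + p.2) := by
  have hG := finite_bandSet n
  rw [finsum_mem_split (hG.subset fun _ h => h.1)
    (fun p => p.1 = 1 - 2 * min p.2.2.1 p.2.2.2)]
  have h1 : ∑ᶠ p ∈ {p ∈ {p ∈ bandSet n | p.2.1 = 0} | ¬ p.1 = 1 - 2 * min p.2.2.1 p.2.2.2},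
      paritySign (p.1 + p.2.2.1 + p.2.2.2) = 0 := by
    refine finsum_mem_eq_zero_of_involution
      (fun p => (if p.1 % 2 = 0 then p.1 + 1 else p.1 - 1, p.2)) ?_ ?_ ?_
    · rintro ⟨u, v, d, e⟩ ⟨⟨⟨hd, he, h, h1, h2⟩, h3⟩, h4⟩
      dsimp only at *
      subst h3
      rw [sub_zero, abs_lt] at h1 h2
      refine ⟨⟨⟨hd, he, ?_, ?_, ?_⟩, rfl⟩, ?_⟩ <;> dsimp only
      · linarith
      · rw [abs_lt]
        split_ifs <;> omega
      · rw [abs_lt]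
        split_ifs <;> omega
      · split_ifs <;> omega
    · rintro ⟨u, v, d, e⟩ -
      ext <;> dsimp only
      split_ifs <;> omega
    · rintro ⟨u, v, d, e⟩ -
      dsimp only
      unfold paritySign
      split_ifs <;> omega
  rw [h1, add_zero, ← finsum_mem_neg_distrib _ (finite_productSet n)]
  refine finsum_mem_bij (fun p => p.2.2) (fun p => (1 - 2 * min p.1 p.2, 0, p)) ?_ ?_ ?_ ?_ ?_
  · rintro ⟨u, v, d, e⟩ ⟨⟨⟨hd, he, h, -⟩, h3⟩, -⟩
    dsimp only at *
    subst h3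
    exact ⟨hd, he, by linarith⟩
  · rintro ⟨d, e⟩ ⟨hd, he, h⟩
    dsimp only at *
    refine ⟨⟨⟨hd, he, ?_, ?_, ?_⟩, rfl⟩, rfl⟩ <;> dsimp only
    · linarith
    · rw [abs_lt]; omega
    · rw [abs_lt]; omega
  · rintro ⟨u, v, d, e⟩ ⟨⟨-, h3⟩, h4⟩
    ext <;> dsimp only at * <;> omega
  · simp
  · rintro ⟨u, v, d, e⟩ ⟨-, h4⟩
    dsimp only at *
    unfold paritySign
    split_ifs <;> omega

theorem sum_bandSet_eq_half (n : ℤ) :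
    ∑ᶠ p ∈ bandSet n, paritySign (p.1 + p.2.2.1 + p.2.2.2) =
      2 * ∑ᶠ p ∈ {p ∈ {p ∈ bandSet n | 0 < p.2.1} | 0 ≤ p.2.2.1 - p.2.2.2},
        swapWeight (p.2.2.1 - p.2.2.2) * paritySign (p.1 + p.2.2.1 + p.2.2.2) -
      ∑ᶠ p ∈ productSet n, paritySign (p.1 + p.2) := by
  have hG := finite_bandSet n
  have h1 : ∑ᶠ p ∈ {p ∈ {p ∈ bandSet n | ¬ p.2.1 = 0} | ¬ 0 < p.2.1},
        paritySign (p.1 + p.2.2.1 + p.2.2.2) =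
      ∑ᶠ p ∈ {p ∈ bandSet n | 0 < p.2.1}, paritySign (p.1 + p.2.2.1 + p.2.2.2) := by
    refine finsum_mem_bij (fun p => (-p.1, -p.2.1, p.2.2)) (fun p => (-p.1, -p.2.1, p.2.2))
      ?_ ?_ (by simp) (by simp) ?_
    · rintro ⟨u, v, d, e⟩ ⟨⟨⟨hd, he, h, h1, h2⟩, h3⟩, h4⟩
      dsimp only at *
      rw [abs_sub_comm] at h1 h2
      refine ⟨⟨hd, he, ?_, ?_, ?_⟩, ?_⟩ <;> dsimp only <;>
        first | omega | linarith | rwa [neg_sub_neg]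
    · rintro ⟨u, v, d, e⟩ ⟨⟨hd, he, h, h1, h2⟩, h3⟩
      dsimp only at *
      rw [abs_sub_comm] at h1 h2
      refine ⟨⟨⟨hd, he, ?_, ?_, ?_⟩, ?_⟩, ?_⟩ <;> dsimp only <;>
        first | omega | linarith | rwa [neg_sub_neg]
    · rintro ⟨u, v, d, e⟩ -
      exact paritySign_congr (by dsimp only; omega)
  have h2 : ∑ᶠ p ∈ {p ∈ {p ∈ bandSet n | ¬ p.2.1 = 0} | 0 < p.2.1},
        paritySign (p.1 + p.2.2.1 + p.2.2.2) =
      ∑ᶠ p ∈ {p ∈ bandSet n | 0 < p.2.1}, paritySign (p.1 + p.2.2.1 + p.2.2.2) := by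
    refine finsum_mem_congr (Set.ext fun p => ?_) fun _ _ => rfl
    exact ⟨fun h => ⟨h.1.1, h.2⟩, fun h => ⟨⟨h.1, h.2.ne'⟩, h.2⟩⟩
  have h3 : ∑ᶠ p ∈ {p ∈ bandSet n | 0 < p.2.1}, paritySign (p.1 + p.2.2.1 + p.2.2.2) =
      ∑ᶠ p ∈ {p ∈ {p ∈ bandSet n | 0 < p.2.1} | 0 ≤ p.2.2.1 - p.2.2.2},
        swapWeight (p.2.2.1 - p.2.2.2) * paritySign (p.1 + p.2.2.1 + p.2.2.2) := by
    refine finsum_mem_symmetrize (hG.subset fun _ h => h.1)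
      (fun p => (p.1, p.2.1, p.2.2.2, p.2.2.1)) (fun p => p.2.2.1 - p.2.2.2) _ ?_ ?_ ?_ ?_
    · rintro ⟨u, v, d, e⟩ ⟨⟨hd, he, h, h1, h2⟩, h3⟩
      exact ⟨⟨he, hd, by rw [← h]; ring, h2, h1⟩, h3⟩
    · simp
    · simp
    · intro p _
      dsimp only
      congr 1
      ring
  rw [finsum_mem_split hG (fun p => p.2.1 = 0), sum_bandSet_axis,
    finsum_mem_split (hG.subset fun _ h => h.1) (fun p => 0 < p.2.1), h1, h2, h3]
  ring

/-- The representations `a b + c m = n` by positive integers with `a ≤ b`. -/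
def orderedSet (n : ℤ) : Set (ℤ × ℤ × ℤ × ℤ) :=
  {p | 0 < p.1 ∧ p.1 ≤ p.2.1 ∧ 0 < p.2.2.1 ∧ 0 < p.2.2.2 ∧ p.1 * p.2.1 + p.2.2.1 * p.2.2.2 = n}

theorem finite_orderedSet (n : ℤ) : (orderedSet n).Finite := by
  refine ((Set.finite_Icc 0 n).prod ((Set.finite_Icc 0 n).prod
    ((Set.finite_Icc 0 n).prod (Set.finite_Icc 0 n)))).subset ?_
  rintro ⟨a, b, c, m⟩ ⟨ha, hb, hc, hm, h⟩
  simp only [Set.mem_prod, Set.mem_Icc] at *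
  refine ⟨⟨?_, ?_⟩, ⟨?_, ?_⟩, ⟨?_, ?_⟩, ?_, ?_⟩ <;> nlinarith

/-- The set obtained by dropping the upper bound on `u - v` in half of `bandSet`. -/
def upperSet (n : ℤ) : Set (ℤ × ℤ × ℤ × ℤ) :=
  {p | 0 < p.2.1 ∧ 0 < p.2.2.2 ∧ p.2.2.2 ≤ p.2.2.1 ∧ p.1 * p.2.1 + p.2.2.1 * p.2.2.2 = n ∧
    p.2.1 - 2 * p.2.2.2 < p.1}

theorem finite_upperSet (n : ℤ) : (upperSet n).Finite := by
  refine ((Set.finite_Icc (-4 * n) n).prod ((Set.finite_Icc 0 n).prod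
    ((Set.finite_Icc 0 (n + 4 * n * n)).prod (Set.finite_Icc 0 (2 * n))))).subset ?_
  rintro ⟨u, v, d, e⟩ ⟨hv, he, hed, h, h1⟩
  simp only [Set.mem_prod, Set.mem_Icc] at *
  have h2 : (v - 2 * e + 1) * v ≤ u * v := mul_le_mul_of_nonneg_right (by omega) hv.le
  have h3 : e * e ≤ d * e := mul_le_mul_of_nonneg_right hed he.le
  have h4 : (e - v) ^ 2 + v ≤ n := by nlinarith
  have h5 := Int.le_self_sq (e - v)
  have h7 := sq_nonneg (e - v)
  have h8 : u ≤ n := by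
    by_contra! h'
    nlinarith
  have h9 : -4 * n ≤ u := by omega
  have h10 : d ≤ n + 4 * n * n := by
    have : -4 * n * v ≤ u * v := mul_le_mul_of_nonneg_right h9 hv.le
    nlinarith
  refine ⟨⟨?_, ?_⟩, ⟨?_, ?_⟩, ⟨?_, ?_⟩, ?_, ?_⟩ <;> omega

theorem sum_half_bandSet_eq (n : ℤ) :
    ∑ᶠ p ∈ {p ∈ {p ∈ bandSet n | 0 < p.2.1} | 0 ≤ p.2.2.1 - p.2.2.2},
        swapWeight (p.2.2.1 - p.2.2.2) * paritySign (p.1 + p.2.2.1 + p.2.2.2) =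
      ∑ᶠ p ∈ upperSet n,
        swapWeight (p.2.2.1 - p.2.2.2) * paritySign (p.1 + p.2.2.1 + p.2.2.2) -
      ∑ᶠ p ∈ {p ∈ upperSet n | ¬ p.1 < p.2.1 + 2 * p.2.2.2},
        swapWeight (p.2.2.1 - p.2.2.2) * paritySign (p.1 + p.2.2.1 + p.2.2.2) := by
  rw [finsum_mem_split (finite_upperSet n) (fun p => p.1 < p.2.1 + 2 * p.2.2.2),
    add_sub_cancel_right]
  refine finsum_mem_congr (Set.ext ?_) fun _ _ => rfl
  rintro ⟨u, v, d, e⟩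
  constructor
  · rintro ⟨⟨⟨hd, he, h, h1, h2⟩, hv⟩, hed⟩
    dsimp only at *
    rw [abs_lt] at h2
    exact ⟨⟨hv, he, by dsimp only; omega, h, by dsimp only; omega⟩, by dsimp only; omega⟩
  · rintro ⟨⟨hv, he, hed, h, h1⟩, h2⟩
    dsimp only at *
    exact ⟨⟨⟨by dsimp only; omega, he, h, by dsimp only; rw [abs_lt]; omega,
      by dsimp only; rw [abs_lt]; omega⟩, hv⟩, by dsimp only; omega⟩

theorem sum_upperSet_le (n : ℤ) :
    ∑ᶠ p ∈ {p ∈ upperSet n | p.2.2.2 ≤ p.2.1},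
        swapWeight (p.2.2.1 - p.2.2.2) * paritySign (p.1 + p.2.2.1 + p.2.2.2) =
      ∑ᶠ p ∈ productSet n, (2 * p.2 - 1) * paritySign (p.1 + p.2) +
      ∑ᶠ p ∈ {p ∈ orderedSet n | p.1 < p.2.1 ∧ p.2.1 ≤ p.1 + p.2.2.2},
        swapWeight (p.1 + p.2.2.2 - p.2.1) * paritySign (p.1 + p.2.2.1 + p.2.2.2) := by
  have h0 : ∑ᶠ p ∈ productSet n, (2 * p.2 - 1) * paritySign (p.1 + p.2) =
      ∑ᶠ p ∈ productSet n, ∑ b ∈ Finset.Icc 1 p.2,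
        swapWeight (p.2 - b) * paritySign (p.1 + p.2) := by
    refine finsum_mem_congr rfl fun p hp => ?_
    rw [← Finset.sum_mul, sum_Icc_swapWeight hp.2.1]
  rw [h0, ← finsum_mem_fiberwise (finite_productSet n) (fun p => Finset.Icc 1 p.2)
    (fun q => swapWeight (q.1.2 - q.2) * paritySign (q.1.1 + q.1.2)),
    finsum_mem_split ((finite_upperSet n).subset fun _ h => h.1) (fun p => p.2.1 = p.2.2.2)]
  congr 1
  · refine finsum_mem_bij (fun p => ((p.2.2.2, p.1 + p.2.2.1), p.1 + p.2.2.2))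
      (fun q => (q.2 - q.1.1, q.1.1, q.1.2 - q.2 + q.1.1, q.1.1)) ?_ ?_ ?_ ?_ ?_
    · rintro ⟨u, v, d, e⟩ ⟨⟨⟨hv, he, hed, h, h1⟩, -⟩, h2⟩
      dsimp only at *
      subst h2
      refine ⟨⟨he, ?_, ?_⟩, ?_⟩ <;> dsimp only
      · omega
      · linarith
      · rw [Finset.mem_Icc]; omega
    · rintro ⟨⟨c, m⟩, b⟩ ⟨⟨hc, hm, h⟩, h1⟩
      dsimp only at *
      rw [Finset.mem_Icc] at h1
      refine ⟨⟨⟨hc, hc, ?_, ?_, ?_⟩, le_rfl⟩, rfl⟩ <;> dsimp only <;> first | omega | linarith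
    · rintro ⟨u, v, d, e⟩ ⟨-, h2⟩
      dsimp only at *
      ext <;> dsimp only <;> omega
    · rintro ⟨⟨c, m⟩, b⟩ -
      ext <;> dsimp only <;> omega
    · rintro ⟨u, v, d, e⟩ -
      dsimp only
      congr 2 <;> ring
  · refine finsum_mem_bij
      (fun p => (p.2.1 - p.2.2.2, p.1 + p.2.2.2, p.2.2.2, p.2.2.1 + p.1 - p.2.1 + p.2.2.2))
      (fun p => (p.2.1 - p.2.2.1, p.1 + p.2.2.1, p.2.2.2 - p.2.1 + p.1 + p.2.2.1, p.2.2.1))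
      ?_ ?_ ?_ ?_ ?_
    · rintro ⟨u, v, d, e⟩ ⟨⟨⟨hv, he, hed, h, h1⟩, h3⟩, h2⟩
      dsimp only at *
      refine ⟨⟨?_, ?_, ?_, ?_, ?_⟩, ?_, ?_⟩ <;> dsimp only <;> first | omega | linarith
    · rintro ⟨a, b, c, m⟩ ⟨⟨ha, hb, hc, hm, h⟩, h1, h2⟩
      dsimp only at *
      refine ⟨⟨⟨?_, ?_, ?_, ?_, ?_⟩, ?_⟩, ?_⟩ <;> dsimp only <;> first | omega | linarith
    · rintro ⟨u, v, d, e⟩ -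
      ext <;> dsimp only <;> omega
    · rintro ⟨a, b, c, m⟩ -
      ext <;> dsimp only <;> omega
    · rintro ⟨u, v, d, e⟩ -
      dsimp only
      congr 2 <;> ring

theorem sum_upperSet_gt (n : ℤ) :
    ∑ᶠ p ∈ {p ∈ upperSet n | ¬ p.2.2.2 ≤ p.2.1},
        swapWeight (p.2.2.1 - p.2.2.2) * paritySign (p.1 + p.2.2.1 + p.2.2.2) =
      ∑ᶠ p ∈ {p ∈ orderedSet n | p.2.1 < p.1 + p.2.2.2},
        swapWeight (p.2.1 - p.1) * paritySign (p.2.2.1 + p.2.2.2) := by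
  refine finsum_mem_bij
    (fun p => (p.2.2.2 - p.2.1, p.2.2.1 - p.2.1, p.2.1, p.1 - p.2.1 + p.2.2.2 + p.2.2.1))
    (fun p => (p.2.2.2 - p.1 - p.2.1 - p.2.2.1, p.2.2.1, p.2.1 + p.2.2.1, p.1 + p.2.2.1))
    ?_ ?_ ?_ ?_ ?_
  · rintro ⟨u, v, d, e⟩ ⟨⟨hv, he, hed, h, h1⟩, h3⟩
    dsimp only at *
    refine ⟨⟨?_, ?_, ?_, ?_, ?_⟩, ?_⟩ <;> dsimp only <;> first | omega | linarith
  · rintro ⟨a, b, c, m⟩ ⟨⟨ha, hb, hc, hm, h⟩, h1⟩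
    dsimp only at *
    refine ⟨⟨?_, ?_, ?_, ?_, ?_⟩, ?_⟩ <;> dsimp only <;> first | omega | linarith
  · rintro ⟨u, v, d, e⟩ -
    ext <;> dsimp only <;> omega
  · rintro ⟨a, b, c, m⟩ -
    ext <;> dsimp only <;> omega
  · rintro ⟨u, v, d, e⟩ -
    dsimp only
    congr 2 <;> ring

theorem sum_upperSet_far_le (n : ℤ) :
    ∑ᶠ p ∈ {p ∈ {p ∈ upperSet n | ¬ p.1 < p.2.1 + 2 * p.2.2.2} |
          p.2.2.1 + p.2.1 + p.2.2.2 ≤ p.1},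
        swapWeight (p.2.2.1 - p.2.2.2) * paritySign (p.1 + p.2.2.1 + p.2.2.2) =
      ∑ᶠ p ∈ productSet n, (if p.1 ≤ p.2 then
        swapWeight (p.2 - p.1) * ∑ c ∈ Finset.Icc 1 (p.1 - 1), paritySign c else 0) +
      ∑ᶠ p ∈ {p ∈ orderedSet n | p.2.2.1 < p.1},
        swapWeight (p.2.1 - p.1) * paritySign (p.2.2.1 + p.2.2.2) := by
  rw [← finsum_mem_sep_eq_ite]
  simp only [Finset.mul_sum]
  rw [← finsum_mem_fiberwise ((finite_productSet n).subset fun _ h => h.1)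
      (fun p => Finset.Icc 1 (p.1 - 1)) (fun q => swapWeight (q.1.2 - q.1.1) * paritySign q.2),
    finsum_mem_split ((finite_upperSet n).subset fun _ h => h.1.1)
      (fun p => p.2.2.1 + p.2.1 + p.2.2.2 = p.1)]
  congr 1
  · refine finsum_mem_bij (fun p => ((p.2.1 + p.2.2.2, p.2.1 + p.2.2.1), p.2.1))
      (fun q => (q.1.1 + q.1.2 - q.2, q.2, q.1.2 - q.2, q.1.1 - q.2)) ?_ ?_ ?_ ?_ ?_
    · rintro ⟨u, v, d, e⟩ ⟨⟨⟨⟨hv, he, hed, h, h1⟩, -⟩, -⟩, h2⟩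
      dsimp only at *
      subst h2
      refine ⟨⟨⟨?_, ?_, ?_⟩, ?_⟩, ?_⟩ <;> dsimp only <;>
        first | omega | linarith | (rw [Finset.mem_Icc]; omega)
    · rintro ⟨⟨a, b⟩, c⟩ ⟨⟨⟨ha, hb, h⟩, h1⟩, h2⟩
      dsimp only at *
      rw [Finset.mem_Icc] at h2
      refine ⟨⟨⟨⟨?_, ?_, ?_, ?_, ?_⟩, ?_⟩, ?_⟩, ?_⟩ <;> dsimp only <;> first | omega | linarith
    · rintro ⟨u, v, d, e⟩ ⟨-, h2⟩
      dsimp only at *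
      ext <;> dsimp only <;> omega
    · rintro ⟨⟨a, b⟩, c⟩ -
      ext <;> dsimp only <;> omega
    · rintro ⟨u, v, d, e⟩ ⟨-, h2⟩
      dsimp only at *
      rw [paritySign_congr (k := u + d + e) (l := v) (by omega)]
      congr 2
      ring
  · refine finsum_mem_bij
      (fun p => (p.2.1 + p.2.2.2, p.2.1 + p.2.2.1, p.2.1, p.1 - p.2.1 - p.2.2.2 - p.2.2.1))
      (fun p => (p.2.2.2 + p.1 + p.2.1 - p.2.2.1, p.2.2.1, p.2.1 - p.2.2.1, p.1 - p.2.2.1))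
      ?_ ?_ ?_ ?_ ?_
    · rintro ⟨u, v, d, e⟩ ⟨⟨⟨⟨hv, he, hed, h, h1⟩, h3⟩, h4⟩, h2⟩
      dsimp only at *
      refine ⟨⟨?_, ?_, ?_, ?_, ?_⟩, ?_⟩ <;> dsimp only <;> first | omega | linarith
    · rintro ⟨a, b, c, m⟩ ⟨⟨ha, hb, hc, hm, h⟩, h1⟩
      dsimp only at *
      refine ⟨⟨⟨⟨?_, ?_, ?_, ?_, ?_⟩, ?_⟩, ?_⟩, ?_⟩ <;> dsimp only <;> first | omega | linarith
    · rintro ⟨u, v, d, e⟩ -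
      ext <;> dsimp only <;> omega
    · rintro ⟨a, b, c, m⟩ -
      ext <;> dsimp only <;> omega
    · rintro ⟨u, v, d, e⟩ -
      dsimp only
      rw [paritySign_congr (k := u + d + e) (l := v + (u - v - e - d)) (by omega)]
      congr 2
      ring

theorem sum_upperSet_far_gt (n : ℤ) :
    ∑ᶠ p ∈ {p ∈ {p ∈ upperSet n | ¬ p.1 < p.2.1 + 2 * p.2.2.2} |
          ¬ p.2.2.1 + p.2.1 + p.2.2.2 ≤ p.1},
        swapWeight (p.2.2.1 - p.2.2.2) * paritySign (p.1 + p.2.2.1 + p.2.2.2) =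
      ∑ᶠ p ∈ {p ∈ orderedSet n | p.2.2.1 < p.1},
        2 * paritySign (p.1 + p.2.2.1 + p.2.2.2) := by
  refine finsum_mem_bij
    (fun p => (p.2.1 + p.2.2.2, p.1 - p.2.2.2, p.2.2.2, p.2.2.1 + p.2.1 + p.2.2.2 - p.1))
    (fun p => (p.2.1 + p.2.2.1, p.1 - p.2.2.1, p.2.2.2 + p.2.1 - p.1 + p.2.2.1, p.2.2.1))
    ?_ ?_ ?_ ?_ ?_
  · rintro ⟨u, v, d, e⟩ ⟨⟨⟨hv, he, hed, h, h1⟩, h3⟩, h4⟩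
    dsimp only at *
    refine ⟨⟨?_, ?_, ?_, ?_, ?_⟩, ?_⟩ <;> dsimp only <;> first | omega | linarith
  · rintro ⟨a, b, c, m⟩ ⟨⟨ha, hb, hc, hm, h⟩, h1⟩
    dsimp only at *
    refine ⟨⟨⟨?_, ?_, ?_, ?_, ?_⟩, ?_⟩, ?_⟩ <;> dsimp only <;> first | omega | linarith
  · rintro ⟨u, v, d, e⟩ -
    ext <;> dsimp only <;> omega
  · rintro ⟨a, b, c, m⟩ -
    ext <;> dsimp only <;> omega
  · rintro ⟨u, v, d, e⟩ ⟨⟨⟨hv, he, hed, h, h1⟩, h3⟩, h4⟩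
    dsimp only at *
    rw [swapWeight, if_neg (by omega)]
    congr 1
    exact paritySign_congr (by omega)

theorem sum_orderedSet_shift (n : ℤ) (f g : ℤ × ℤ × ℤ × ℤ → ℤ)
    (h : ∀ a b c m, f (a, b, c, m) = g (a, b - m, c + a, m)) :
    ∑ᶠ p ∈ orderedSet n, (if p.1 + p.2.2.2 ≤ p.2.1 then f p else 0) =
      ∑ᶠ p ∈ orderedSet n, if p.1 < p.2.2.1 then g p else 0 := by
  rw [← finsum_mem_sep_eq_ite, ← finsum_mem_sep_eq_ite]
  refine finsum_mem_bij (fun p => (p.1, p.2.1 - p.2.2.2, p.2.2.1 + p.1, p.2.2.2))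
    (fun p => (p.1, p.2.1 + p.2.2.2, p.2.2.1 - p.1, p.2.2.2)) ?_ ?_ (by simp) (by simp) ?_
  · rintro ⟨a, b, c, m⟩ ⟨⟨ha, hb, hc, hm, h⟩, h1⟩
    dsimp only at *
    refine ⟨⟨?_, ?_, ?_, ?_, ?_⟩, ?_⟩ <;> dsimp only <;> first | omega | linarith
  · rintro ⟨a, b, c, m⟩ ⟨⟨ha, hb, hc, hm, h⟩, h1⟩
    dsimp only at *
    refine ⟨⟨?_, ?_, ?_, ?_, ?_⟩, ?_⟩ <;> dsimp only <;> first | omega | linarith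
  · rintro ⟨a, b, c, m⟩ -
    exact h a b c m

theorem sum_orderedSet_combine (n : ℤ) :
    ∑ᶠ p ∈ {p ∈ orderedSet n | p.1 < p.2.1 ∧ p.2.1 ≤ p.1 + p.2.2.2},
        swapWeight (p.1 + p.2.2.2 - p.2.1) * paritySign (p.1 + p.2.2.1 + p.2.2.2) +
      ∑ᶠ p ∈ {p ∈ orderedSet n | p.2.1 < p.1 + p.2.2.2},
        swapWeight (p.2.1 - p.1) * paritySign (p.2.2.1 + p.2.2.2) -
      ∑ᶠ p ∈ {p ∈ orderedSet n | p.2.2.1 < p.1},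
        swapWeight (p.2.1 - p.1) * paritySign (p.2.2.1 + p.2.2.2) -
      ∑ᶠ p ∈ {p ∈ orderedSet n | p.2.2.1 < p.1},
        2 * paritySign (p.1 + p.2.2.1 + p.2.2.2) =
    2 * ∑ᶠ p ∈ {p ∈ orderedSet n | p.2.2.1 = p.1},
        (paritySign (p.1 + p.2.2.1 + p.2.2.2) + paritySign (p.2.2.1 + p.2.2.2)) -
      2 * ∑ᶠ p ∈ {p ∈ orderedSet n | p.2.1 = p.1}, paritySign (p.1 + p.2.2.1 + p.2.2.2) -
      ∑ᶠ p ∈ {p ∈ {p ∈ orderedSet n | p.2.2.1 = p.1} | p.2.1 = p.1},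
        paritySign (p.2.2.1 + p.2.2.2) := by
  have e1 := sum_orderedSet_shift n (fun p => paritySign (p.1 + p.2.2.1 + p.2.2.2))
    (fun p => paritySign (p.2.2.1 + p.2.2.2)) fun a b c m => by dsimp only; congr 1; ring
  have e2 := sum_orderedSet_shift n (fun p => paritySign (p.2.2.1 + p.2.2.2))
    (fun p => paritySign (p.1 + p.2.2.1 + p.2.2.2)) fun a b c m =>
      paritySign_congr (by dsimp only; omega)
  have e3 := sum_orderedSet_shift n
    (fun p => if p.2.1 = p.1 + p.2.2.2 then paritySign (p.1 + p.2.2.1 + p.2.2.2) else 0)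
    (fun p => if p.2.1 = p.1 then paritySign (p.2.2.1 + p.2.2.2) else 0) fun a b c m => by
      dsimp only
      rw [add_comm c a]
      simp only [sub_eq_iff_eq_add]
  simp only [finsum_mem_sep_eq_ite] at e1 e2 e3 ⊢
  simp only [finsum_mem_eq_finite_toFinset_sum _ (finite_orderedSet n)] at e1 e2 e3 ⊢
  rw [← sub_eq_zero] at e1 e2 e3 ⊢
  rw [← Finset.sum_sub_distrib] at e1 e2 e3
  simp only [Finset.mul_sum, ← Finset.sum_sub_distrib, ← Finset.sum_add_distrib]
  have e4 := congrArg₂ (· + ·) (congrArg₂ (· + ·) (congrArg (-2 * ·) e1) (congrArg (-2 * ·) e2)) e3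
  simp only [mul_zero, add_zero, Finset.mul_sum, ← Finset.sum_add_distrib] at e4
  refine Eq.trans (Finset.sum_congr rfl ?_) e4
  rintro ⟨a, b, c, m⟩ hp
  obtain ⟨ha, hb, hc, hm, -⟩ := (Set.Finite.mem_toFinset _).1 hp
  dsimp only at *
  generalize paritySign (a + c + m) = s
  generalize paritySign (c + m) = t
  unfold swapWeight
  rcases lt_trichotomy a c with h1 | h1 | h1 <;> rcases hb.lt_or_eq with h2 | h2 <;>
    rcases lt_trichotomy b (a + m) with h3 | h3 | h3 <;>
    first
    | omega
    | (simp (disch := omega) only [if_pos, if_neg]; ring)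

theorem sum_squareProductSet_eq (n : ℤ) :
    ∑ᶠ p ∈ squareProductSet n, paritySign (p.1 + p.2.1 + p.2.2) =
      ∑ᶠ p ∈ productSet n, paritySign (p.1 + p.2) +
      2 * ∑ᶠ p ∈ {p ∈ orderedSet n | p.2.1 = p.1}, paritySign (p.1 + p.2.2.1 + p.2.2.2) := by
  have hS := finite_squareProductSet n
  have h1 : ∑ᶠ p ∈ {p ∈ squareProductSet n | p.1 = 0}, paritySign (p.1 + p.2.1 + p.2.2) =
      ∑ᶠ p ∈ productSet n, paritySign (p.1 + p.2) := by
    refine finsum_mem_bij (fun p => p.2) (fun p => (0, p)) ?_ ?_ ?_ (by simp) ?_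
    · rintro ⟨i, d, e⟩ ⟨⟨hd, he, h⟩, h'⟩
      dsimp only at *
      subst h'
      exact ⟨hd, he, by linarith⟩
    · rintro ⟨d, e⟩ ⟨hd, he, h⟩
      exact ⟨⟨hd, he, by dsimp only at *; linarith⟩, rfl⟩
    · rintro ⟨i, d, e⟩ ⟨-, h'⟩
      exact Prod.ext h'.symm rfl
    · rintro ⟨i, d, e⟩ ⟨-, h'⟩
      exact paritySign_congr (by dsimp only at *; omega)
  have h2 : ∑ᶠ p ∈ {p ∈ {p ∈ squareProductSet n | ¬ p.1 = 0} | 0 < p.1},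
        paritySign (p.1 + p.2.1 + p.2.2) =
      ∑ᶠ p ∈ {p ∈ orderedSet n | p.2.1 = p.1}, paritySign (p.1 + p.2.2.1 + p.2.2.2) := by
    refine finsum_mem_bij (fun p => (p.1, p)) (fun p => p.2) ?_ ?_ (by simp) ?_ ?_
    · rintro ⟨i, d, e⟩ ⟨⟨⟨hd, he, h⟩, -⟩, h'⟩
      exact ⟨⟨h', le_rfl, hd, he, by dsimp only at *; linarith⟩, rfl⟩
    · rintro ⟨a, b, c, m⟩ ⟨⟨ha, hb, hc, hm, h⟩, h1⟩
      dsimp only at *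
      subst h1
      exact ⟨⟨⟨hc, hm, by dsimp only at *; linarith⟩, ha.ne'⟩, ha⟩
    · rintro ⟨a, b, c, m⟩ ⟨-, h1⟩
      exact Prod.ext h1 rfl
    · simp
  have h3 : ∑ᶠ p ∈ {p ∈ {p ∈ squareProductSet n | ¬ p.1 = 0} | ¬ 0 < p.1},
        paritySign (p.1 + p.2.1 + p.2.2) =
      ∑ᶠ p ∈ {p ∈ {p ∈ squareProductSet n | ¬ p.1 = 0} | 0 < p.1},
        paritySign (p.1 + p.2.1 + p.2.2) := by
    refine finsum_mem_bij (fun p => (-p.1, p.2)) (fun p => (-p.1, p.2)) ?_ ?_ (by simp) (by simp) ?_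
    · rintro ⟨i, d, e⟩ ⟨⟨⟨hd, he, h⟩, h1⟩, h2⟩
      dsimp only at *
      refine ⟨⟨⟨hd, he, ?_⟩, ?_⟩, ?_⟩ <;> dsimp only <;> first | omega | linarith
    · rintro ⟨i, d, e⟩ ⟨⟨⟨hd, he, h⟩, h1⟩, h2⟩
      dsimp only at *
      refine ⟨⟨⟨hd, he, ?_⟩, ?_⟩, ?_⟩ <;> dsimp only <;> first | omega | linarith
    · rintro ⟨i, d, e⟩ -
      exact paritySign_congr (by dsimp only at *; omega)
  rw [finsum_mem_split hS (fun p => p.1 = 0), h1,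
    finsum_mem_split (hS.subset fun _ h => h.1) (fun p => 0 < p.1), h3, h2]
  ring

theorem sum_orderedSet_middle (n : ℤ) :
    ∑ᶠ p ∈ {p ∈ orderedSet n | p.2.2.1 = p.1},
        (paritySign (p.1 + p.2.2.1 + p.2.2.2) + paritySign (p.2.2.1 + p.2.2.2)) =
      ∑ᶠ p ∈ productSet n, if p.1 < p.2 then
        (1 + paritySign p.1) * (if (p.2 - p.1) % 2 = 0 then 0 else -1) else 0 := by
  rw [← finsum_mem_sep_eq_ite]
  have h0 : ∀ p ∈ {p ∈ productSet n | p.1 < p.2},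
      (1 + paritySign p.1) * (if (p.2 - p.1) % 2 = 0 then 0 else -1) =
      ∑ m ∈ Finset.Icc 1 (p.2 - p.1), (1 + paritySign p.1) * paritySign m := fun p hp => by
    rw [← Finset.mul_sum, sum_Icc_paritySign (sub_nonneg.2 hp.2.le)]
  rw [finsum_mem_congr rfl h0,
    ← finsum_mem_fiberwise ((finite_productSet n).subset fun _ h => h.1)
      (fun p => Finset.Icc 1 (p.2 - p.1)) (fun q => (1 + paritySign q.1.1) * paritySign q.2)]
  refine finsum_mem_bij (fun p => ((p.1, p.2.1 + p.2.2.2), p.2.2.2))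
    (fun q => (q.1.1, q.1.2 - q.2, q.1.1, q.2)) ?_ ?_ ?_ ?_ ?_
  · rintro ⟨a, b, c, m⟩ ⟨⟨ha, hb, hc, hm, h⟩, h1⟩
    dsimp only at *
    subst h1
    refine ⟨⟨⟨?_, ?_, ?_⟩, ?_⟩, ?_⟩ <;> dsimp only <;>
      first | omega | linarith | (rw [Finset.mem_Icc]; omega)
  · rintro ⟨⟨a, b⟩, m⟩ ⟨⟨⟨ha, hb, h⟩, h1⟩, h2⟩
    dsimp only at *
    rw [Finset.mem_Icc] at h2
    refine ⟨⟨?_, ?_, ?_, ?_, ?_⟩, ?_⟩ <;> dsimp only <;> first | omega | linarith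
  · rintro ⟨a, b, c, m⟩ ⟨-, h1⟩
    dsimp only at *
    ext <;> dsimp only <;> omega
  · rintro ⟨⟨a, b⟩, m⟩ -
    ext <;> dsimp only
    omega
  · rintro ⟨a, b, c, m⟩ ⟨-, h1⟩
    dsimp only at *
    subst h1
    rw [add_mul, ← paritySign_add, one_mul]
    congr 1
    exact paritySign_congr (by omega)

theorem sum_orderedSet_corner (n : ℤ) :
    ∑ᶠ p ∈ {p ∈ {p ∈ orderedSet n | p.2.2.1 = p.1} | p.2.1 = p.1},
        paritySign (p.2.2.1 + p.2.2.2) =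
      ∑ᶠ p ∈ productSet n, if p.1 < p.2 then paritySign p.2 else 0 := by
  rw [← finsum_mem_sep_eq_ite]
  refine finsum_mem_bij (fun p => (p.1, p.2.1 + p.2.2.2)) (fun q => (q.1, q.1, q.1, q.2 - q.1))
    ?_ ?_ ?_ ?_ ?_
  · rintro ⟨a, b, c, m⟩ ⟨⟨⟨ha, hb, hc, hm, h⟩, h1⟩, h2⟩
    dsimp only at *
    subst h1
    refine ⟨⟨?_, ?_, ?_⟩, ?_⟩ <;> dsimp only <;> first | omega | linarith
  · rintro ⟨a, b⟩ ⟨⟨ha, hb, h⟩, h1⟩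
    dsimp only at *
    refine ⟨⟨⟨?_, ?_, ?_, ?_, ?_⟩, ?_⟩, ?_⟩ <;> dsimp only <;> first | omega | linarith
  · rintro ⟨a, b, c, m⟩ ⟨⟨-, h1⟩, h2⟩
    dsimp only at *
    ext <;> dsimp only <;> omega
  · rintro ⟨a, b⟩ -
    ext <;> dsimp only
    omega
  · rintro ⟨a, b, c, m⟩ ⟨⟨-, h1⟩, h2⟩
    exact paritySign_congr (by dsimp only at *; omega)

theorem sum_sq_eq {n : ℤ} (hn : 0 < n) :
    ∑ᶠ x ∈ {x : ℤ | x ^ 2 = n}, paritySign x =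
      ∑ᶠ p ∈ productSet n, if p.1 = p.2 then 2 * paritySign p.1 else 0 := by
  have h1 : ∑ᶠ x ∈ {x ∈ {x : ℤ | x ^ 2 = n} | 0 < x}, paritySign x =
      ∑ᶠ p ∈ {p ∈ productSet n | p.1 = p.2}, paritySign p.1 := by
    refine finsum_mem_bij (fun x => (x, x)) (fun p => p.1) ?_ ?_ (by simp) ?_ (by simp)
    · rintro x ⟨h, hx⟩
      exact ⟨⟨hx, hx, by rw [← sq]; exact h⟩, rfl⟩
    · rintro ⟨a, b⟩ ⟨⟨ha, hb, h⟩, h1⟩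
      dsimp only at *
      subst h1
      exact ⟨by rw [← h]; exact sq a, ha⟩
    · rintro ⟨a, b⟩ ⟨-, h1⟩
      exact Prod.ext rfl h1
  have h2 : ∑ᶠ x ∈ {x ∈ {x : ℤ | x ^ 2 = n} | ¬ 0 < x}, paritySign x =
      ∑ᶠ x ∈ {x ∈ {x : ℤ | x ^ 2 = n} | 0 < x}, paritySign x := by
    refine finsum_mem_bij (fun x => -x) (fun x => -x) ?_ ?_ (by simp) (by simp) ?_
    · rintro x ⟨h, hx⟩
      have h' : x ^ 2 = n := h
      have : x ≠ 0 := by rintro rfl; omega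
      exact ⟨(neg_sq x).trans h', by omega⟩
    · rintro x ⟨h, hx⟩
      exact ⟨(neg_sq x).trans h, by omega⟩
    · exact fun x _ => paritySign_congr (by omega)
  rw [finsum_mem_split (finite_sq_eq n) (fun x => 0 < x), h2, h1, ← two_mul, mul_finsum_mem,
    finsum_mem_sep_eq_ite]

/-- The coefficient identity behind `thetaSeries * tripleSeries = divisorSeries`. -/
theorem sum_squareTripleSet_eq {n : ℤ} (hn : 0 < n) :
    6 * ∑ᶠ p ∈ squareProductSet n, paritySign (p.1 + p.2.1 + p.2.2) +
        4 * ∑ᶠ p ∈ squareTripleSet n, paritySign (p.1 + p.2.1 + p.2.2.1 + p.2.2.2) =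
      8 * ∑ᶠ p ∈ productSet n, p.2 * paritySign (p.1 + p.2) +
        ∑ᶠ x ∈ {x : ℤ | x ^ 2 = n}, paritySign x := by
  have hU := finite_upperSet n
  have hP := finite_productSet n
  have e1 := sum_bandSet_eq n
  rw [sum_bandSet_eq_half, sum_half_bandSet_eq,
    finsum_mem_split hU (fun p => p.2.2.2 ≤ p.2.1),
    finsum_mem_split (S := {p ∈ upperSet n | ¬ p.1 < p.2.1 + 2 * p.2.2.2})
      (hU.subset fun _ h => h.1) (fun p => p.2.2.1 + p.2.1 + p.2.2.2 ≤ p.1),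
    sum_upperSet_le, sum_upperSet_gt, sum_upperSet_far_le, sum_upperSet_far_gt] at e1
  have e2 := sum_orderedSet_combine n
  rw [sum_orderedSet_middle, sum_orderedSet_corner] at e2
  have e3 := sum_squareProductSet_eq n
  have e4 := sum_productSet_eq n
  have e5 := sum_sq_eq hn
  have e6 : ∑ᶠ p ∈ productSet n, (2 * p.2 - 1) * paritySign (p.1 + p.2) =
      2 * ∑ᶠ p ∈ productSet n, p.2 * paritySign (p.1 + p.2) -
        ∑ᶠ p ∈ productSet n, paritySign (p.1 + p.2) := by
    rw [mul_finsum_mem, ← finsum_mem_sub_distrib _ _ hP]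
    exact finsum_mem_congr rfl fun p _ => by ring
  have e7 : -2 * ∑ᶠ p ∈ productSet n, paritySign (p.1 + p.2) -
      4 * ∑ᶠ p ∈ productSet n, (if p.1 ≤ p.2 then
        swapWeight (p.2 - p.1) * ∑ c ∈ Finset.Icc 1 (p.1 - 1), paritySign c else 0) +
      8 * (∑ᶠ p ∈ productSet n, if p.1 < p.2 then
        (1 + paritySign p.1) * (if (p.2 - p.1) % 2 = 0 then 0 else -1) else 0) -
      4 * (∑ᶠ p ∈ productSet n, if p.1 < p.2 then paritySign p.2 else 0) =
      ∑ᶠ x ∈ {x : ℤ | x ^ 2 = n}, paritySign x := by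
    rw [e4, e5, finsum_mem_sep_eq_ite]
    simp only [mul_finsum_mem]
    rw [← finsum_mem_sub_distrib _ _ hP, ← finsum_mem_add_distrib hP,
      ← finsum_mem_sub_distrib _ _ hP]
    refine finsum_mem_congr rfl ?_
    rintro ⟨a, b⟩ ⟨ha, hb, -⟩
    dsimp only at *
    rw [sum_Icc_paritySign (by omega)]
    unfold paritySign swapWeight
    rcases lt_trichotomy a b with h1 | h1 | h1 <;>
      rcases Int.emod_two_eq_zero_or_one a with h2 | h2 <;>
      rcases Int.emod_two_eq_zero_or_one b with h3 | h3 <;>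
      first
      | omega
      | (simp (disch := omega) only [if_pos, if_neg]; norm_num)
  linarith

/-- The generating series of a graded family of sets with weights. -/
noncomputable def weightSeries {α : Type*} (A : ℤ → Set α) (w : α → ℤ) : PowerSeries ℤ :=
  PowerSeries.mk fun n => ∑ᶠ a ∈ A n, w a

theorem coeff_weightSeries {α : Type*} (A : ℤ → Set α) (w : α → ℤ) (n : ℕ) :
    PowerSeries.coeff n (weightSeries A w) = ∑ᶠ a ∈ A n, w a :=
  PowerSeries.coeff_mk _ _

theorem coeff_weightSeries_mul {α β : Type*} {A : ℤ → Set α} {B : ℤ → Set β} (w : α → ℤ)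
    (v : β → ℤ) (dA : α → ℤ) (dB : β → ℤ) (hA : ∀ n, (A n).Finite) (hB : ∀ n, (B n).Finite)
    (hdA : ∀ n, ∀ a ∈ A n, dA a = n) (hdB : ∀ n, ∀ b ∈ B n, dB b = n)
    (hdA₀ : ∀ n, ∀ a ∈ A n, 0 ≤ n) (hdB₀ : ∀ n, ∀ b ∈ B n, 0 ≤ n) (n : ℕ) :
    PowerSeries.coeff n (weightSeries A w * weightSeries B v) =
      ∑ᶠ p ∈ {p : α × β | p.1 ∈ A (dA p.1) ∧ p.2 ∈ B (dB p.2) ∧ dA p.1 + dB p.2 = n},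
        w p.1 * v p.2 := by
  simp only [PowerSeries.coeff_mul, coeff_weightSeries]
  have h1 : ∀ ij ∈ Finset.HasAntidiagonal.antidiagonal n,
      (∑ᶠ a ∈ A (ij.1 : ℕ), w a) * (∑ᶠ b ∈ B (ij.2 : ℕ), v b) =
      ∑ p ∈ (hA (ij.1 : ℕ)).toFinset ×ˢ (hB (ij.2 : ℕ)).toFinset, w p.1 * v p.2 := by
    intro ij _
    rw [finsum_mem_eq_finite_toFinset_sum _ (hA _), finsum_mem_eq_finite_toFinset_sum _ (hB _),
      Finset.sum_mul_sum, Finset.sum_product]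
  rw [Finset.sum_congr rfl h1, ← finsum_mem_coe_finset,
    ← finsum_mem_fiberwise (Finset.finite_toSet _)
      (fun ij : ℕ × ℕ => (hA (ij.1 : ℕ)).toFinset ×ˢ (hB (ij.2 : ℕ)).toFinset)
      (fun q => w q.2.1 * v q.2.2)]
  refine finsum_mem_bij (fun q => q.2) (fun p => (((dA p.1).toNat, (dB p.2).toNat), p))
    ?_ ?_ ?_ (by simp) (by simp)
  · rintro ⟨⟨i, j⟩, a, b⟩ ⟨h4, h2⟩
    simp only [Finset.mem_coe, Finset.HasAntidiagonal.mem_antidiagonal, Finset.mem_product,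
      Set.Finite.mem_toFinset, Set.mem_ofPred_eq] at h4 h2 ⊢
    rw [hdA _ _ h2.1, hdB _ _ h2.2]
    exact ⟨h2.1, h2.2, by omega⟩
  · rintro ⟨a, b⟩ ⟨h4, h2, h3⟩
    have h5 : 0 ≤ dA a := hdA₀ _ _ h4
    have h6 : 0 ≤ dB b := hdB₀ _ _ h2
    simp only [Finset.mem_coe, Finset.HasAntidiagonal.mem_antidiagonal, Finset.mem_product,
      Set.Finite.mem_toFinset, Set.mem_ofPred_eq] at h3 h4 h2 ⊢
    rw [Int.toNat_of_nonneg h5, Int.toNat_of_nonneg h6]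
    exact ⟨by omega, h4, h2⟩
  · rintro ⟨⟨i, j⟩, a, b⟩ ⟨-, h2⟩
    simp only [Finset.mem_product, Set.Finite.mem_toFinset] at h2
    rw [hdA _ _ h2.1, hdB _ _ h2.2]
    rfl

theorem X_mul_derivative_weightSeries {α : Type*} (A : ℤ → Set α) (w d : α → ℤ)
    (hd : ∀ n, ∀ a ∈ A n, d a = n) :
    PowerSeries.X * PowerSeries.derivative ℤ (weightSeries A w) =
      weightSeries A (fun a => d a * w a) := by
  ext n
  have h : ∀ n : ℕ, ∑ᶠ a ∈ A n, d a * w a = n * ∑ᶠ a ∈ A n, w a := by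
    intro n
    rw [mul_finsum_mem]
    exact finsum_mem_congr rfl fun a ha => by rw [hd _ _ ha]
  rw [coeff_weightSeries, h]
  rcases n with _ | n
  · simp
  · rw [PowerSeries.coeff_succ_X_mul, PowerSeries.coeff_derivative, coeff_weightSeries]
    push_cast
    ring

/-- A power series whose logarithmic derivative is `k` times that of `f` is `f ^ k`. -/
theorem eq_pow_of_mul_derivative_eq {f g : PowerSeries ℤ} (k : ℕ)
    (hf : PowerSeries.constantCoeff f = 1) (hg : PowerSeries.constantCoeff g = 1)
    (h : f * PowerSeries.derivative ℤ g = k * PowerSeries.derivative ℤ f * g) : g = f ^ k := by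
  have hu : IsUnit (f ^ k) := by
    rw [PowerSeries.isUnit_iff_constantCoeff]
    simp [hf]
  obtain ⟨q, rfl⟩ := hu.dvd (a := g)
  have hf0 : f ≠ 0 := by
    rintro rfl
    simp at hf
  have hq : PowerSeries.constantCoeff q = 1 := by simpa [hf] using hg
  have h1 : f ^ (k + 1) * PowerSeries.derivative ℤ q = 0 := by
    rw [Derivation.leibniz, Derivation.leibniz_pow] at h
    simp only [smul_eq_mul, nsmul_eq_mul] at h
    rcases k with _ | k
    · simpa using h
    · rw [Nat.add_sub_cancel] at h
      linear_combination h
  have h2 : PowerSeries.derivative ℤ q = 0 :=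
    (mul_eq_zero.1 h1).resolve_left (pow_ne_zero _ hf0)
  have h3 : q = 1 := PowerSeries.derivative.ext (by simpa using h2) (by simpa using hq)
  rw [h3, mul_one]

/-- The theta series `∑ (-1) ^ x q ^ (x ^ 2)`. -/
noncomputable def thetaSeries : PowerSeries ℤ :=
  weightSeries (fun n => {x : ℤ | x ^ 2 = n}) paritySign

theorem productSet_eq_empty {n : ℤ} (hn : n ≤ 0) : productSet n = ∅ := by
  refine Set.eq_empty_of_forall_notMem ?_
  rintro ⟨c, m⟩ ⟨hc, hm, h⟩
  have := mul_pos hc hm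
  dsimp only at *
  omega

theorem tripleSet_eq_empty {n : ℤ} (hn : n ≤ 0) : tripleSet n = ∅ := by
  refine Set.eq_empty_of_forall_notMem ?_
  rintro ⟨r, s, t⟩ ⟨hr, hs, ht, h⟩
  dsimp only at *
  have := mul_pos hr hs
  have := mul_pos hr ht
  have := mul_pos hs ht
  linarith

theorem coeff_thetaSeries_mul_productSet (w : ℤ × ℤ → ℤ) (v : ℤ → ℤ) (n : ℕ) :
    PowerSeries.coeff n (weightSeries (fun n => {x : ℤ | x ^ 2 = n}) v *
        weightSeries productSet w) =
      ∑ᶠ p ∈ squareProductSet n, v p.1 * w p.2 := by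
  rw [coeff_weightSeries_mul _ _ (fun x => x ^ 2) (fun p => p.1 * p.2) finite_sq_eq
    finite_productSet (fun n x h => h) (fun n p h => h.2.2) (fun n x h => h ▸ sq_nonneg x)
    (fun n p h => h.2.2 ▸ (mul_pos h.1 h.2.1).le)]
  refine finsum_mem_congr (Set.ext ?_) fun _ _ => rfl
  rintro ⟨x, c, m⟩
  exact ⟨fun h => ⟨h.2.1.1, h.2.1.2.1, h.2.2⟩, fun h => ⟨rfl, ⟨h.1, h.2.1, rfl⟩, h.2.2⟩⟩

theorem tripleSet_degree_nonneg (n : ℤ) (p : ℤ × ℤ × ℤ) (h : p ∈ tripleSet n) : 0 ≤ n := by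
  by_contra! hn
  rw [tripleSet_eq_empty hn.le] at h
  exact h

theorem coeff_thetaSeries_mul_tripleSet (w : ℤ × ℤ × ℤ → ℤ) (n : ℕ) :
    PowerSeries.coeff n (thetaSeries * weightSeries tripleSet w) =
      ∑ᶠ p ∈ squareTripleSet n, paritySign p.1 * w p.2 := by
  rw [thetaSeries, coeff_weightSeries_mul _ _ (fun x => x ^ 2)
    (fun p => p.1 * p.2.1 + p.1 * p.2.2 + p.2.1 * p.2.2) finite_sq_eq
    finite_tripleSet (fun n x h => h) (fun n p h => h.2.2.2) (fun n x h => h ▸ sq_nonneg x)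
    tripleSet_degree_nonneg]
  refine finsum_mem_congr (Set.ext ?_) fun _ _ => rfl
  rintro ⟨x, r, s, t⟩
  exact ⟨fun h => ⟨h.2.1.1, h.2.1.2.1, h.2.1.2.2.1, h.2.2⟩,
    fun h => ⟨rfl, ⟨h.1, h.2.1, h.2.2.1, rfl⟩, h.2.2.2⟩⟩

theorem constantCoeff_thetaSeries : PowerSeries.constantCoeff thetaSeries = 1 := by
  rw [← PowerSeries.coeff_zero_eq_constantCoeff_apply, thetaSeries, coeff_weightSeries]
  have : {x : ℤ | x ^ 2 = (0 : ℕ)} = {0} := by ext; simp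
  rw [this, finsum_mem_singleton]
  rfl

/-- The divisor-sum series that equals `thetaSeries ^ 4`. -/
noncomputable def divisorSeries : PowerSeries ℤ :=
  1 - 4 * weightSeries productSet fun p => (p.1 + p.2) * paritySign (p.1 + p.2)

theorem divisorSeries_eq : divisorSeries = thetaSeries ^ 4 := by
  refine eq_pow_of_mul_derivative_eq 4 constantCoeff_thetaSeries ?_ ?_
  · rw [← PowerSeries.coeff_zero_eq_constantCoeff_apply, divisorSeries,
      show (4 : PowerSeries ℤ) = PowerSeries.C 4 from rfl, map_sub, PowerSeries.coeff_C_mul,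
      coeff_weightSeries, productSet_eq_empty (by simp)]
    simp
  · refine mul_left_cancel₀ PowerSeries.X_ne_zero ?_
    have h1 : PowerSeries.X * PowerSeries.derivative ℤ divisorSeries =
        -4 * weightSeries productSet
          (fun p => p.1 * p.2 * ((p.1 + p.2) * paritySign (p.1 + p.2))) := by
      rw [← X_mul_derivative_weightSeries productSet
          (fun p => (p.1 + p.2) * paritySign (p.1 + p.2)) (fun p => p.1 * p.2)
          (fun n p h => h.2.2),
        divisorSeries, show (4 : PowerSeries ℤ) = PowerSeries.C 4 from rfl, map_sub,
        Derivation.leibniz, PowerSeries.derivative_C, PowerSeries.derivative_one]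
      simp
      ring
    have h2 : PowerSeries.X * PowerSeries.derivative ℤ thetaSeries =
        weightSeries (fun n => {x : ℤ | x ^ 2 = n}) (fun x => x ^ 2 * paritySign x) :=
      X_mul_derivative_weightSeries _ _ (fun x => x ^ 2) (fun n x h => h)
    suffices h : -(thetaSeries * weightSeries productSet
          (fun p => p.1 * p.2 * ((p.1 + p.2) * paritySign (p.1 + p.2)))) =
        weightSeries (fun n => {x : ℤ | x ^ 2 = n}) (fun x => x ^ 2 * paritySign x) -
        PowerSeries.C 4 * (weightSeries (fun n => {x : ℤ | x ^ 2 = n})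
            (fun x => x ^ 2 * paritySign x) *
          weightSeries productSet (fun p => (p.1 + p.2) * paritySign (p.1 + p.2))) by
      rw [show PowerSeries.C (4 : ℤ) = 4 from rfl] at h
      rw [mul_left_comm, h1]
      push_cast
      trans 4 * (PowerSeries.X * PowerSeries.derivative ℤ thetaSeries) * divisorSeries
      · rw [h2, divisorSeries]
        linear_combination 4 * h
      · ring
    ext n
    rw [map_neg, map_sub, PowerSeries.coeff_C_mul, thetaSeries,
      coeff_thetaSeries_mul_productSet, coeff_thetaSeries_mul_productSet, coeff_weightSeries]
    have h3 := sum_squareProductSet_weighted n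
    have h4 : ∀ p ∈ squareProductSet n, paritySign (p.1 + p.2.1 + p.2.2) *
        ((p.2.1 * p.2.2 - 4 * p.1 ^ 2) * (p.2.1 + p.2.2)) =
        paritySign p.1 * (p.2.1 * p.2.2 * ((p.2.1 + p.2.2) * paritySign (p.2.1 + p.2.2))) -
        4 * (p.1 ^ 2 * paritySign p.1 * ((p.2.1 + p.2.2) * paritySign (p.2.1 + p.2.2))) := by
      intro p _
      rw [add_assoc, paritySign_add]
      ring
    rw [finsum_mem_congr rfl h4, finsum_mem_sub_distrib _ _ (finite_squareProductSet n),
      ← mul_finsum_mem] at h3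
    simp only [mul_comm (paritySign _) (_ ^ 2)] at h3
    linear_combination -h3

/-- The series of the right-hand side of the Andrews–Crandall identity. -/
noncomputable def tripleSeries : PowerSeries ℤ :=
  1 - 6 * weightSeries productSet (fun p => paritySign (p.1 + p.2)) -
    4 * weightSeries tripleSet fun p => paritySign (p.1 + p.2.1 + p.2.2)

theorem thetaSeries_mul_tripleSeries : thetaSeries * tripleSeries = divisorSeries := by
  rw [show thetaSeries * tripleSeries = thetaSeries -
      PowerSeries.C 6 * (thetaSeries * weightSeries productSet fun p => paritySign (p.1 + p.2)) -
      PowerSeries.C 4 * (thetaSeries * weightSeries tripleSet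
        fun p => paritySign (p.1 + p.2.1 + p.2.2)) by
    rw [tripleSeries, show PowerSeries.C (6 : ℤ) = 6 from rfl,
      show PowerSeries.C (4 : ℤ) = 4 from rfl]
    ring, divisorSeries, show (4 : PowerSeries ℤ) = PowerSeries.C 4 from rfl]
  ext n
  rcases n.eq_zero_or_pos with rfl | hn
  · have h := constantCoeff_thetaSeries
    simp only [PowerSeries.coeff_zero_eq_constantCoeff_apply, map_sub, map_mul, h]
    simp only [← PowerSeries.coeff_zero_eq_constantCoeff_apply, coeff_weightSeries]
    rw [productSet_eq_empty (by simp), tripleSet_eq_empty (by simp)]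
    simp
  · simp only [map_sub, PowerSeries.coeff_C_mul, coeff_thetaSeries_mul_tripleSet]
    rw [thetaSeries, coeff_thetaSeries_mul_productSet, coeff_weightSeries, coeff_weightSeries,
      PowerSeries.coeff_one, if_neg hn.ne']
    have h := sum_squareTripleSet_eq (n := n) (by exact_mod_cast hn)
    have h1 : ∑ᶠ p ∈ productSet n, (p.1 + p.2) * paritySign (p.1 + p.2) =
        2 * ∑ᶠ p ∈ productSet n, p.2 * paritySign (p.1 + p.2) := by
      have h2 : ∑ᶠ p ∈ productSet n, p.1 * paritySign (p.1 + p.2) =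
          ∑ᶠ p ∈ productSet n, p.2 * paritySign (p.1 + p.2) := by
        refine finsum_mem_bij Prod.swap Prod.swap ?_ ?_ (by simp) (by simp) (by simp [add_comm])
        all_goals exact fun p h => ⟨h.2.1, h.1, by rw [← h.2.2]; exact mul_comm _ _⟩
      simp only [add_mul]
      rw [finsum_mem_add_distrib (finite_productSet n), h2, two_mul]
    simp only [← paritySign_add, ← add_assoc] at *
    rw [h1]
    linear_combination -h

theorem tripleSeries_eq : tripleSeries = thetaSeries ^ 3 := by
  refine mul_left_cancel₀ (a := thetaSeries) ?_ ?_
  · intro h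
    have := constantCoeff_thetaSeries
    simp [h] at this
  · rw [thetaSeries_mul_tripleSeries, divisorSeries_eq]
    ring

theorem paritySign_sq (x : ℤ) : paritySign (x ^ 2) = paritySign x := by
  refine paritySign_congr ?_
  rw [← Int.even_iff, Int.even_sub, Int.even_pow]
  simp

theorem finite_sum_two_squares (n : ℤ) : {v : ℤ × ℤ | v.1 ^ 2 + v.2 ^ 2 = n}.Finite := by
  refine ((Set.finite_Icc (-n) n).prod (Set.finite_Icc (-n) n)).subset ?_
  rintro ⟨x, y⟩ h
  simp only [Set.mem_prod, Set.mem_Icc, Set.mem_ofPred_eq] at *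
  have h1 := Int.le_self_sq x
  have h2 := Int.le_self_sq (-x)
  have h3 := Int.le_self_sq y
  have h4 := Int.le_self_sq (-y)
  rw [neg_sq] at h2 h4
  refine ⟨⟨?_, ?_⟩, ?_, ?_⟩ <;> linarith [sq_nonneg x, sq_nonneg y]

theorem finite_sum_three_squares (n : ℤ) :
    {v : ℤ × ℤ × ℤ | v.1 ^ 2 + v.2.1 ^ 2 + v.2.2 ^ 2 = n}.Finite := by
  refine ((Set.finite_Icc (-n) n).prod
    ((Set.finite_Icc (-n) n).prod (Set.finite_Icc (-n) n))).subset ?_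
  rintro ⟨x, y, z⟩ h
  simp only [Set.mem_prod, Set.mem_Icc, Set.mem_ofPred_eq] at *
  have h1 := Int.le_self_sq x
  have h2 := Int.le_self_sq (-x)
  have h3 := Int.le_self_sq y
  have h4 := Int.le_self_sq (-y)
  have h5 := Int.le_self_sq z
  have h6 := Int.le_self_sq (-z)
  rw [neg_sq] at h2 h4 h6
  refine ⟨⟨?_, ?_⟩, ⟨?_, ?_⟩, ?_, ?_⟩ <;> linarith [sq_nonneg x, sq_nonneg y, sq_nonneg z]

theorem coeff_thetaSeries_pow_three (n : ℕ) :
    PowerSeries.coeff n (thetaSeries ^ 3) = paritySign n * r3 n := by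
  have h2 : thetaSeries * thetaSeries =
      weightSeries (fun n => {v : ℤ × ℤ | v.1 ^ 2 + v.2 ^ 2 = n})
        (fun v => paritySign v.1 * paritySign v.2) := by
    ext n
    rw [thetaSeries, coeff_weightSeries_mul _ _ (fun x => x ^ 2) (fun x => x ^ 2) finite_sq_eq
      finite_sq_eq (fun n x h => h) (fun n x h => h) (fun n x h => h ▸ sq_nonneg x)
      (fun n x h => h ▸ sq_nonneg x), coeff_weightSeries]
    refine finsum_mem_congr (Set.ext ?_) fun _ _ => rfl
    rintro ⟨x, y⟩
    exact ⟨fun h => h.2.2, fun h => ⟨rfl, rfl, h⟩⟩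
  rw [pow_succ', sq, h2, thetaSeries, coeff_weightSeries_mul paritySign _ (fun x => x ^ 2)
    (fun v : ℤ × ℤ => v.1 ^ 2 + v.2 ^ 2) finite_sq_eq finite_sum_two_squares (fun n x h => h)
    (fun n v h => h) (fun n x h => h ▸ sq_nonneg x)
    (fun n v h => h ▸ add_nonneg (sq_nonneg _) (sq_nonneg _))]
  trans ∑ᶠ v ∈ {v : ℤ × ℤ × ℤ | v.1 ^ 2 + v.2.1 ^ 2 + v.2.2 ^ 2 = (n : ℤ)}, paritySign n * 1
  · refine finsum_mem_congr (Set.ext ?_) ?_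
    · rintro ⟨x, y, z⟩
      exact ⟨fun h => by rw [← h.2.2]; exact add_assoc _ _ _,
        fun h => ⟨rfl, rfl, by rw [← h]; exact (add_assoc _ _ _).symm⟩⟩
    · rintro ⟨x, y, z⟩ h
      rw [← show x ^ 2 + y ^ 2 + z ^ 2 = (n : ℤ) from h, paritySign_add, paritySign_add,
        paritySign_sq, paritySign_sq, paritySign_sq]
      ring
  · have hF := finite_sum_three_squares n
    rw [← mul_finsum_mem, r3, finsum_mem_eq_finite_toFinset_sum _ hF,
      Set.ncard_eq_toFinset_card _ hF]
    simp

/-- The Andrews–Crandall identity: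
`r₃(n) = 6 (−1)^{n+1} Σ_{rs = n} (−1)^{r+s} + 4 (−1)^{n+1} Σ_{rs+rt+st = n} (−1)^{r+s+t}`,
the sums over ordered pairs/triples of positive integers. -/
theorem andrews_crandall (n : ℕ) (hn : 0 < n) :
    (r3 n : ℤ) =
      6 * (-1) ^ (n + 1) *
          (∑ᶠ p ∈ {p : ℕ × ℕ | 1 ≤ p.1 ∧ 1 ≤ p.2 ∧ p.1 * p.2 = n},
            (-1 : ℤ) ^ (p.1 + p.2))
        + 4 * (-1) ^ (n + 1) *
          (∑ᶠ p ∈ {p : ℕ × ℕ × ℕ | 1 ≤ p.1 ∧ 1 ≤ p.2.1 ∧ 1 ≤ p.2.2 ∧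
              p.1 * p.2.1 + p.1 * p.2.2 + p.2.1 * p.2.2 = n},
            (-1 : ℤ) ^ (p.1 + p.2.1 + p.2.2)) := by
  have h1 : ∑ᶠ p ∈ {p : ℕ × ℕ | 1 ≤ p.1 ∧ 1 ≤ p.2 ∧ p.1 * p.2 = n}, (-1 : ℤ) ^ (p.1 + p.2) =
      ∑ᶠ p ∈ productSet n, paritySign (p.1 + p.2) := by
    refine finsum_mem_bij (fun p => (p.1, p.2)) (fun p => (p.1.toNat, p.2.toNat)) ?_ ?_ (by simp)
      ?_ ?_
    · rintro ⟨c, m⟩ ⟨hc, hm, h⟩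
      exact ⟨Int.natCast_pos.2 hc, Int.natCast_pos.2 hm, by dsimp only at *; exact_mod_cast h⟩
    · rintro ⟨c, m⟩ ⟨hc, hm, h⟩
      dsimp only at *
      lift c to ℕ using hc.le
      lift m to ℕ using hm.le
      exact ⟨by exact_mod_cast hc, by exact_mod_cast hm, by exact_mod_cast h⟩
    · rintro ⟨c, m⟩ ⟨hc, hm, -⟩
      exact Prod.ext (Int.toNat_of_nonneg hc.le) (Int.toNat_of_nonneg hm.le)
    · rintro ⟨c, m⟩ -
      exact (paritySign_natCast _).symm
  have h2 : ∑ᶠ p ∈ {p : ℕ × ℕ × ℕ | 1 ≤ p.1 ∧ 1 ≤ p.2.1 ∧ 1 ≤ p.2.2 ∧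
        p.1 * p.2.1 + p.1 * p.2.2 + p.2.1 * p.2.2 = n}, (-1 : ℤ) ^ (p.1 + p.2.1 + p.2.2) =
      ∑ᶠ p ∈ tripleSet n, paritySign (p.1 + p.2.1 + p.2.2) := by
    refine finsum_mem_bij (fun p => (p.1, p.2.1, p.2.2))
      (fun p => (p.1.toNat, p.2.1.toNat, p.2.2.toNat)) ?_ ?_ (by simp) ?_ ?_
    · rintro ⟨r, s, t⟩ ⟨hr, hs, ht, h⟩
      exact ⟨Int.natCast_pos.2 hr, Int.natCast_pos.2 hs, Int.natCast_pos.2 ht,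
        by dsimp only at *; exact_mod_cast h⟩
    · rintro ⟨r, s, t⟩ ⟨hr, hs, ht, h⟩
      dsimp only at *
      lift r to ℕ using hr.le
      lift s to ℕ using hs.le
      lift t to ℕ using ht.le
      exact ⟨by exact_mod_cast hr, by exact_mod_cast hs, by exact_mod_cast ht,
        by exact_mod_cast h⟩
    · rintro ⟨r, s, t⟩ ⟨hr, hs, ht, -⟩
      exact Prod.ext (Int.toNat_of_nonneg hr.le)
        (Prod.ext (Int.toNat_of_nonneg hs.le) (Int.toNat_of_nonneg ht.le))
    · rintro ⟨r, s, t⟩ -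
      exact (paritySign_natCast _).symm
  have h := congrArg (PowerSeries.coeff n) tripleSeries_eq
  rw [coeff_thetaSeries_pow_three, tripleSeries, show (6 : PowerSeries ℤ) = PowerSeries.C 6 from rfl,
    show (4 : PowerSeries ℤ) = PowerSeries.C 4 from rfl, map_sub, map_sub, PowerSeries.coeff_C_mul,
    PowerSeries.coeff_C_mul, coeff_weightSeries, coeff_weightSeries, PowerSeries.coeff_one,
    if_neg hn.ne', paritySign_natCast] at h
  rw [h1, h2]
  have h3 : ((-1) ^ n * (-1) ^ n : ℤ) = 1 := by rw [← mul_pow]; simp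
  linear_combination (-(-1) ^ n) * h - (r3 n : ℤ) * h3
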